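/- Let H ∈ (1/2,1) and let c_H = (H(2H−1)/B(2−2H, H−1/2))^{1/2}. The Volterra kernel K_H(t,s) = c_H · 1_{[0,t]}(s) · s^{1/2−H} ∫_s^t u^{H−1/2}(u−s)^{H−3/2} du satisfies ∫_0^{s∧t} K_H(t,u) K_H(s,u) du = (1/2)(s^{2H} + t^{2H} − |t−s|^{2H}) for all s, t ∈ [0,T]. -/

import Mathlib

open MeasureTheory Set Real
open scoped ENNReal

/-- Euler Beta function `B(a,b) = ∫_0^1 t^(a-1)(1-t)^(b-1) dt`. -/
noncomputable def betaFn (a b : ℝ) : ℝ :=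
  ∫ t in Ioc (0:ℝ) 1, t ^ (a - 1) * (1 - t) ^ (b - 1)

/-- The Volterra kernel `K_H(t,s)` of fractional Brownian motion. -/
noncomputable def volterraKernel (H t s : ℝ) : ℝ :=
  (H * (2 * H - 1) / betaFn (2 - 2 * H) (H - 1/2)) ^ ((1:ℝ)/2) *
    (Icc (0:ℝ) t).indicator
      (fun s' => s' ^ ((1:ℝ)/2 - H) *
        ∫ u in Ioc s' t, u ^ (H - 1/2) * (u - s') ^ (H - 3/2)) s


lemma aux_subst {a y z : ℝ} (hy : 0 < y) (hyz : y < z) :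
    ∫⁻ w in Ioo (0:ℝ) 1, ENNReal.ofReal (w ^ (-(2 * a)) * (1 - w) ^ (a - 1)) =
      ENNReal.ofReal ((z - y) ^ (1 - 2 * a) * (y ^ a * z ^ a)) *
      ∫⁻ u in Ioo (0:ℝ) y,
        ENNReal.ofReal (u ^ (-(2 * a)) * ((y - u) ^ (a - 1) * (z - u) ^ (a - 1))) := by
  have hz : 0 < z := hy.trans hyz
  have hd : 0 < z - y := sub_pos.2 hyz
  set f : ℝ → ℝ := fun u => u * (z - y) / (y * (z - u)) with hf
  have himg : f '' Ioo 0 y = Ioo 0 1 := by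
    ext w
    constructor
    · rintro ⟨u, ⟨h0, h1⟩, rfl⟩
      have : 0 < z - u := by linarith
      refine ⟨by positivity, ?_⟩
      rw [hf, div_lt_one (by positivity)]
      nlinarith
    · rintro ⟨h0, h1⟩
      have h2 : 0 < z - y + y * w := by positivity
      refine ⟨y * z * w / (z - y + y * w), ⟨by positivity, ?_⟩, ?_⟩
      · rw [div_lt_iff₀ h2]; nlinarith [mul_pos hy (mul_pos hd (sub_pos.2 h1))]
      · have h3 : z - y * z * w / (z - y + y * w) = z * (z - y) / (z - y + y * w) := by
          field_simp; ring
        simp only [hf]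
        rw [h3]; field_simp
  have hder : ∀ u ∈ Ioo 0 y, HasDerivWithinAt f ((z - y) * z / (y * (z - u) ^ 2)) (Ioo 0 y) u := by
    rintro u ⟨h0, h1⟩
    have h2 : z - u ≠ 0 := by linarith
    have h3 : HasDerivAt f ((1 * (z - y) * (y * (z - u)) - u * (z - y) * (y * (-1))) / (y * (z - u)) ^ 2) u := by
      refine HasDerivAt.fun_div (((hasDerivAt_id u).mul_const _)) ?_ (by positivity)
      exact ((hasDerivAt_id u).const_sub z).const_mul y
    refine (h3.congr_deriv ?_).hasDerivWithinAt
    field_simp; ring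
  have hinj : InjOn f (Ioo 0 y) := by
    rintro u ⟨h0, h1⟩ v ⟨h2, h3⟩ huv
    have h4 : 0 < z - u := by linarith
    have h5 : 0 < z - v := by linarith
    simp only [hf] at huv
    rw [div_eq_div_iff (by positivity) (by positivity)] at huv
    have : (u - v) * ((z - y) * y * z) = 0 := by linear_combination huv
    rcases mul_eq_zero.1 this with h | h
    · linarith
    · exact absurd h (by positivity)
  rw [← himg, lintegral_image_eq_lintegral_abs_deriv_mul measurableSet_Ioo hder hinj,
    ← lintegral_const_mul' _ _ ENNReal.ofReal_ne_top]
  refine setLIntegral_congr_fun measurableSet_Ioo ?_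
  rintro u ⟨h0, h1⟩
  have h2 : 0 < z - u := by linarith
  have h3 : 0 < y - u := by linarith
  simp only
  rw [← ENNReal.ofReal_mul (by positivity), ← ENNReal.ofReal_mul (by positivity)]
  congr 1
  have h4 : 1 - f u = z * (y - u) / (y * (z - u)) := by
    simp only [hf]; field_simp; ring
  rw [h4, abs_of_pos (by positivity)]
  simp only [hf]
  rw [div_rpow (by positivity) (by positivity), div_rpow (by positivity) (by positivity),
    mul_rpow (by positivity) (by positivity), mul_rpow (by positivity) (by positivity),
    mul_rpow (by positivity) (by positivity), mul_rpow (by positivity) (by positivity)]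
  simp only [rpow_sub hd, rpow_sub hy, rpow_sub hz, rpow_sub h2, rpow_sub h3, rpow_neg hd.le,
    rpow_neg hy.le, rpow_neg h2.le, rpow_neg h0.le, rpow_one, two_mul, rpow_add hd, rpow_add hy, rpow_add h2, rpow_add h0]
  field_simp

lemma aux_beta {a b : ℝ} (ha : 0 < a) (hb : 0 < b) :
    0 < betaFn a b ∧ ∫⁻ w in Ioo (0:ℝ) 1, ENNReal.ofReal (w ^ (a - 1) * (1 - w) ^ (b - 1)) =
      ENNReal.ofReal (betaFn a b) := by
  have hint : IntegrableOn (fun w : ℝ => w ^ (a - 1) * (1 - w) ^ (b - 1)) (Ioc 0 1) := by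
    have h := Complex.betaIntegral_convergent (u := a) (v := b) (by simpa) (by simpa)
    rw [intervalIntegrable_iff_integrableOn_Ioc_of_le zero_le_one] at h
    have h2 := h.re
    refine h2.congr ?_
    filter_upwards [ae_restrict_mem measurableSet_Ioc] with x hx
    have e1 : ((x:ℂ)) ^ ((a:ℂ) - 1) = ((x ^ (a-1) : ℝ) : ℂ) := by
      rw [Complex.ofReal_cpow hx.1.le]; simp
    have e2 : (1 - (x:ℂ)) ^ ((b:ℂ) - 1) = (((1 - x) ^ (b-1) : ℝ) : ℂ) := by
      rw [Complex.ofReal_cpow (by linarith [hx.2])]; simp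
    rw [e1, e2, ← Complex.ofReal_mul]
    simp
  have hnn : 0 ≤ᵐ[volume.restrict (Ioc (0:ℝ) 1)] (fun w : ℝ => w ^ (a - 1) * (1 - w) ^ (b - 1)) := by
    filter_upwards [ae_restrict_mem measurableSet_Ioc] with x hx
    exact mul_nonneg (rpow_nonneg hx.1.le _) (rpow_nonneg (by linarith [hx.2]) _)
  constructor
  · unfold betaFn
    rw [setIntegral_pos_iff_support_of_nonneg_ae hnn hint]
    refine lt_of_lt_of_le ?_ (measure_mono (s := Ioo (0:ℝ) 1) ?_)
    · simp
    · intro x hx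
      refine ⟨?_, hx.1, hx.2.le⟩
      have := sub_pos.2 hx.2
      have := hx.1
      rw [Function.mem_support]
      positivity
  · unfold betaFn
    rw [ofReal_integral_eq_lintegral_ofReal hint hnn]
    exact setLIntegral_congr Ioo_ae_eq_Ioc

lemma aux_J {a y z : ℝ} (ha : 0 < a) (ha2 : a < 1/2) (hy : 0 < y) (hyz : y < z) :
    ENNReal.ofReal (y ^ a * z ^ a) * ∫⁻ u in Ioo (0:ℝ) y,
        ENNReal.ofReal (u ^ (-(2 * a)) * ((y - u) ^ (a - 1) * (z - u) ^ (a - 1))) =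
      ENNReal.ofReal (betaFn (1 - 2 * a) a) * ENNReal.ofReal (|y - z| ^ (2 * a - 1)) := by
  have hd : 0 < z - y := sub_pos.2 hyz
  have h1 := (aux_beta (a := 1 - 2 * a) (b := a) (by linarith) ha).2
  rw [show 1 - 2 * a - 1 = -(2 * a) by ring, aux_subst hy hyz] at h1
  rw [← h1, abs_sub_comm, abs_of_pos hd, mul_right_comm, ← ENNReal.ofReal_mul
    (mul_nonneg (rpow_nonneg hd.le _)
      (mul_nonneg (rpow_nonneg hy.le _) (rpow_nonneg (hy.trans hyz).le _)))]
  congr 2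
  rw [mul_right_comm, ← rpow_add hd]
  simp

lemma aux_inner {b s y : ℝ} (hb : 0 < b) (hy : 0 ≤ y) (hys : y ≤ s) :
    ∫⁻ z in Ioc (0:ℝ) s, ENNReal.ofReal (|y - z| ^ (b - 1)) =
      ENNReal.ofReal ((y ^ b + (s - y) ^ b) / b) := by
  have i1 : IntervalIntegrable (fun z : ℝ => |y - z| ^ (b - 1)) volume 0 y := by
    have h := (intervalIntegral.intervalIntegrable_rpow' (a := y - 0) (b := y - y) (r := b - 1) (by linarith)).comp_sub_left y
    simp only [sub_sub_cancel] at h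
    refine h.congr_ae ?_
    rw [uIoc_of_le hy]
    filter_upwards [ae_restrict_mem measurableSet_Ioc] with x hx
    rw [abs_of_nonneg (by linarith [hx.2])]
  have i2 : IntervalIntegrable (fun z : ℝ => |y - z| ^ (b - 1)) volume y s := by
    have h := (intervalIntegral.intervalIntegrable_rpow' (a := y - y) (b := s - y) (r := b - 1) (by linarith)).comp_sub_right y
    simp only [sub_add_cancel] at h
    refine h.congr_ae ?_
    rw [uIoc_of_le hys]
    filter_upwards [ae_restrict_mem measurableSet_Ioc] with x hx
    rw [abs_sub_comm, abs_of_nonneg (by linarith [hx.1])]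
  have e1 : ∫ z in (0:ℝ)..y, |y - z| ^ (b - 1) = y ^ b / b := by
    have : ∫ z in (0:ℝ)..y, |y - z| ^ (b - 1) = ∫ z in (0:ℝ)..y, (y - z) ^ (b - 1) := by
      refine intervalIntegral.integral_congr fun x hx => ?_
      rw [uIcc_of_le hy] at hx
      rw [abs_of_nonneg (by linarith [hx.2])]
    rw [this, intervalIntegral.integral_comp_sub_left (fun x => x ^ (b - 1)) y,
      integral_rpow (Or.inl (by linarith))]
    simp [hb.ne']
  have e2 : ∫ z in y..s, |y - z| ^ (b - 1) = (s - y) ^ b / b := by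
    have : ∫ z in y..s, |y - z| ^ (b - 1) = ∫ z in y..s, (z - y) ^ (b - 1) := by
      refine intervalIntegral.integral_congr fun x hx => ?_
      rw [uIcc_of_le hys] at hx
      rw [abs_sub_comm, abs_of_nonneg (by linarith [hx.1])]
    rw [this, intervalIntegral.integral_comp_sub_right (fun x => x ^ (b - 1)) y,
      integral_rpow (Or.inl (by linarith))]
    simp [hb.ne']
  rw [← ofReal_integral_eq_lintegral_ofReal, ← intervalIntegral.integral_of_le (hy.trans hys),
    ← intervalIntegral.integral_add_adjacent_intervals i1 i2, e1, e2, add_div]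
  · exact (intervalIntegrable_iff_integrableOn_Ioc_of_le (hy.trans hys)).1 (i1.trans i2)
  · exact Filter.Eventually.of_forall fun x => rpow_nonneg (abs_nonneg _) _

lemma aux_outer {b s t : ℝ} (hb : 0 < b) (ht : 0 ≤ t) (hts : t ≤ s) :
    ∫⁻ y in Ioc (0:ℝ) t, ∫⁻ z in Ioc (0:ℝ) s, ENNReal.ofReal (|y - z| ^ (b - 1)) =
      ENNReal.ofReal ((t ^ (b + 1) + s ^ (b + 1) - (s - t) ^ (b + 1)) / (b * (b + 1))) := by
  have h1 : ∫⁻ y in Ioc (0:ℝ) t, ∫⁻ z in Ioc (0:ℝ) s, ENNReal.ofReal (|y - z| ^ (b - 1)) =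
      ∫⁻ y in Ioc (0:ℝ) t, ENNReal.ofReal ((y ^ b + (s - y) ^ b) / b) :=
    setLIntegral_congr_fun measurableSet_Ioc fun y hy => aux_inner hb hy.1.le (hy.2.trans hts)
  have c1 : Continuous fun y : ℝ => y ^ b := continuous_id.rpow_const fun _ => Or.inr hb.le
  have c2 : Continuous fun y : ℝ => (s - y) ^ b := c1.comp (continuous_const.sub continuous_id)
  rw [h1, ← ofReal_integral_eq_lintegral_ofReal, ← intervalIntegral.integral_of_le ht,
    intervalIntegral.integral_div, intervalIntegral.integral_add (c1.intervalIntegrable _ _)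
      (c2.intervalIntegrable _ _), intervalIntegral.integral_comp_sub_left (fun x => x ^ b) s,
      integral_rpow (Or.inl (by linarith)), integral_rpow (Or.inl (by linarith))]
  · congr 1
    rw [zero_rpow (by linarith)]
    have : b + 1 ≠ 0 := by linarith
    field_simp
    simp; ring
  · exact (((c1.add c2).div_const b).continuousOn.integrableOn_Icc).mono_set Ioc_subset_Icc_self
  · filter_upwards [ae_restrict_mem measurableSet_Ioc] with x hx
    exact div_nonneg (add_nonneg (rpow_nonneg hx.1.le _) (rpow_nonneg (by linarith [hx.2]) _)) hb.le

/-- The integrand of the Volterra kernel, cut off at `u < y`, valued in the extended reals. -/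
noncomputable def auxK (a y u : ℝ) : ℝ≥0∞ :=
  if u < y then ENNReal.ofReal (y ^ a * (y - u) ^ (a - 1)) else 0

lemma auxK_meas (a : ℝ) : Measurable fun p : ℝ × ℝ => auxK a p.1 p.2 := by
  unfold auxK
  refine Measurable.ite (measurableSet_lt measurable_snd measurable_fst) ?_ measurable_const
  fun_prop

lemma auxK_meas' (a : ℝ) {α : Type*} [MeasurableSpace α] {f g : α → ℝ} (hf : Measurable f)
    (hg : Measurable g) : Measurable fun p => auxK a (f p) (g p) :=
  (auxK_meas a).comp (hf.prodMk hg)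

lemma aux_J1 {a y z t : ℝ} (ha : 0 < a) (ha2 : a < 1/2) (hy : 0 < y) (hyz : y < z) (hyt : y ≤ t) :
    ∫⁻ u in Ioc (0:ℝ) t, ENNReal.ofReal (u ^ (-(2 * a))) * (auxK a y u * auxK a z u) =
      ENNReal.ofReal (betaFn (1 - 2 * a) a) * ENNReal.ofReal (|y - z| ^ (2 * a - 1)) := by
  rw [← aux_J ha ha2 hy hyz, ← lintegral_const_mul' _ _ ENNReal.ofReal_ne_top,
    ← lintegral_indicator measurableSet_Ioc, ← lintegral_indicator measurableSet_Ioo]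
  refine lintegral_congr fun u => ?_
  by_cases hu : u ∈ Ioo 0 y
  · have h1 : 0 < y - u := sub_pos.2 hu.2
    have h2 : 0 < z - u := by linarith
    have h3 : 0 < z := by linarith
    have h4 := hu.1
    rw [indicator_of_mem hu, indicator_of_mem (show u ∈ Ioc 0 t from ⟨hu.1, hu.2.le.trans hyt⟩)]
    simp only [auxK, if_pos hu.2, if_pos (hu.2.trans hyz)]
    rw [← ENNReal.ofReal_mul (by positivity), ← ENNReal.ofReal_mul (by positivity),
      ← ENNReal.ofReal_mul (by positivity)]
    congr 1; ring
  · rw [indicator_of_notMem hu]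
    by_cases hu2 : u ∈ Ioc 0 t
    · have : ¬ u < y := fun h => hu ⟨hu2.1, h⟩
      rw [indicator_of_mem hu2]
      simp [auxK, this]
    · rw [indicator_of_notMem hu2]

lemma aux_main {a s t : ℝ} (ha : 0 < a) (ha2 : a < 1/2) (hts : t ≤ s) :
    ∫⁻ u in Ioc (0:ℝ) t, ENNReal.ofReal (u ^ (-(2 * a))) *
        ((∫⁻ y in Ioc (0:ℝ) t, auxK a y u) * ∫⁻ z in Ioc (0:ℝ) s, auxK a z u) =
      ENNReal.ofReal (betaFn (1 - 2 * a) a) *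
        ∫⁻ y in Ioc (0:ℝ) t, ∫⁻ z in Ioc (0:ℝ) s, ENNReal.ofReal (|y - z| ^ (2 * a - 1)) := by
  have h1 : ∀ u : ℝ, ENNReal.ofReal (u ^ (-(2 * a))) *
        ((∫⁻ y in Ioc (0:ℝ) t, auxK a y u) * ∫⁻ z in Ioc (0:ℝ) s, auxK a z u) =
      ∫⁻ y in Ioc (0:ℝ) t, ∫⁻ z in Ioc (0:ℝ) s,
        ENNReal.ofReal (u ^ (-(2 * a))) * (auxK a y u * auxK a z u) := by
    intro u
    have m : Measurable fun y => auxK a y u := auxK_meas' a measurable_id measurable_const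
    rw [← lintegral_lintegral_mul m.aemeasurable m.aemeasurable,
      ← lintegral_const_mul' _ _ ENNReal.ofReal_ne_top]
    refine lintegral_congr fun y => ?_
    rw [← lintegral_const_mul' _ _ ENNReal.ofReal_ne_top]
  simp_rw [h1]
  have m3 : Measurable fun p : (ℝ × ℝ) × ℝ =>
      ENNReal.ofReal (p.1.1 ^ (-(2 * a))) * (auxK a p.1.2 p.1.1 * auxK a p.2 p.1.1) := by
    refine Measurable.mul (by fun_prop) (Measurable.mul ?_ ?_)
    · exact auxK_meas' a (by fun_prop) (by fun_prop)
    · exact auxK_meas' a (by fun_prop) (by fun_prop)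
  rw [lintegral_lintegral_swap, ← lintegral_const_mul' _ _ ENNReal.ofReal_ne_top]
  swap
  · exact (m3.lintegral_prod_right').aemeasurable
  refine setLIntegral_congr_fun measurableSet_Ioc fun y hy => ?_
  rw [lintegral_lintegral_swap, ← lintegral_const_mul' _ _ ENNReal.ofReal_ne_top]
  swap
  · exact (m3.comp (f := fun p : ℝ × ℝ => ((p.1, y), p.2)) (by fun_prop)).aemeasurable
  refine lintegral_congr_ae ?_
  have hne : ∀ᵐ z ∂(volume.restrict (Ioc (0:ℝ) s)), z ≠ y :=
    ae_restrict_of_ae (by simp [ae_iff])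
  filter_upwards [ae_restrict_mem measurableSet_Ioc, hne] with z hz hzy
  rcases lt_or_gt_of_ne hzy with h | h
  · rw [abs_sub_comm, ← aux_J1 ha ha2 hz.1 h (h.le.trans hy.2)]
    simp_rw [mul_comm (auxK a y _)]
  · rw [← aux_J1 ha ha2 hy.1 h hy.2]

lemma aux_kernel {H t u : ℝ} (hH : 1/2 < H) (hu : 0 < u) (hut : u ≤ t) :
    0 ≤ ∫ y in Ioc u t, y ^ (H - 1/2) * (y - u) ^ (H - 3/2) ∧
    ENNReal.ofReal (∫ y in Ioc u t, y ^ (H - 1/2) * (y - u) ^ (H - 3/2)) =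
      ∫⁻ y in Ioc (0:ℝ) t, auxK (H - 1/2) y u := by
  have hnn : 0 ≤ᵐ[volume.restrict (Ioc u t)] fun y => y ^ (H - 1/2) * (y - u) ^ (H - 3/2) := by
    filter_upwards [ae_restrict_mem measurableSet_Ioc] with y hy
    exact mul_nonneg (rpow_nonneg (hu.le.trans hy.1.le) _) (rpow_nonneg (by linarith [hy.1]) _)
  have hint : IntegrableOn (fun y : ℝ => y ^ (H - 1/2) * (y - u) ^ (H - 3/2)) (Ioc u t) := by
    rw [← intervalIntegrable_iff_integrableOn_Ioc_of_le hut]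
    have h := (intervalIntegral.intervalIntegrable_rpow' (a := u - u) (b := t - u) (r := H - 3/2) (by linarith)).comp_sub_right u
    simp only [sub_add_cancel] at h
    refine h.continuousOn_mul ?_
    exact (continuous_id.rpow_const fun _ => Or.inr (by linarith)).continuousOn
  refine ⟨integral_nonneg_of_ae hnn, ?_⟩
  rw [ofReal_integral_eq_lintegral_ofReal hint hnn, ← lintegral_indicator measurableSet_Ioc,
    ← lintegral_indicator measurableSet_Ioc]
  refine lintegral_congr fun y => ?_
  by_cases h1 : y ∈ Ioc u t
  · rw [indicator_of_mem h1, indicator_of_mem (show y ∈ Ioc 0 t from ⟨hu.trans h1.1, h1.2⟩)]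
    simp only [auxK, if_pos h1.1]
    rw [show H - 1/2 - 1 = H - 3/2 by ring]
  · rw [indicator_of_notMem h1]
    by_cases h2 : y ∈ Ioc 0 t
    · have : ¬ u < y := fun h => h1 ⟨h, h2.2⟩
      rw [indicator_of_mem h2]
      simp [auxK, this]
    · rw [indicator_of_notMem h2]

lemma aux_final {H s t : ℝ} (hH : H ∈ Ioo (1/2 : ℝ) 1) (ht : 0 ≤ t) (hts : t ≤ s) :
    ∫ u in Ioc (0:ℝ) t, volterraKernel H t u * volterraKernel H s u
      = (1/2) * (s ^ (2 * H) + t ^ (2 * H) - |t - s| ^ (2 * H)) := by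
  obtain ⟨hH1, hH2⟩ := hH
  have hB : 0 < betaFn (2 - 2 * H) (H - 1/2) := (aux_beta (by linarith) (by linarith)).1
  have hX : 0 ≤ H * (2 * H - 1) / betaFn (2 - 2 * H) (H - 1/2) :=
    div_nonneg (mul_nonneg (by linarith) (by linarith)) hB.le
  set X := H * (2 * H - 1) / betaFn (2 - 2 * H) (H - 1/2) with hXdef
  set G : ℝ → ℝ → ℝ≥0∞ := fun r u => ∫⁻ y in Ioc (0:ℝ) r, auxK (H - 1/2) y u with hG
  have hGm : ∀ r, Measurable (G r) := fun r =>
    (auxK_meas' (H - 1/2) (f := fun p : ℝ × ℝ => p.2) (g := fun p : ℝ × ℝ => p.1)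
      measurable_snd measurable_fst).lintegral_prod_right'
  have hV : ∀ r, t ≤ r → ∀ u ∈ Ioc 0 t, 0 ≤ volterraKernel H r u ∧ volterraKernel H r u =
      X ^ ((1:ℝ)/2) * (u ^ ((1:ℝ)/2 - H) * (G r u).toReal) := by
    intro r hr u hu
    obtain ⟨h1, h2⟩ := aux_kernel hH1 hu.1 (hu.2.trans hr)
    have h3 : volterraKernel H r u =
      X ^ ((1:ℝ)/2) * (u ^ ((1:ℝ)/2 - H) * (G r u).toReal) := by
      unfold volterraKernel
      rw [indicator_of_mem (show u ∈ Icc 0 r from ⟨hu.1.le, hu.2.trans hr⟩)]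
      simp only [hG]
      rw [← h2, ENNReal.toReal_ofReal h1]
    refine ⟨?_, h3⟩
    rw [h3]
    exact mul_nonneg (rpow_nonneg hX _) (mul_nonneg (rpow_nonneg hu.1.le _) ENNReal.toReal_nonneg)
  have hGtop : ∀ r, t ≤ r → ∀ u ∈ Ioc 0 t, G r u ≠ ⊤ := by
    intro r hr u hu
    obtain ⟨h1, h2⟩ := aux_kernel hH1 hu.1 (hu.2.trans hr)
    simp only [hG]
    rw [← h2]
    exact ENNReal.ofReal_ne_top
  rw [integral_eq_lintegral_of_nonneg_ae]
  rotate_left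
  · filter_upwards [ae_restrict_mem measurableSet_Ioc] with u hu
    exact mul_nonneg (hV t le_rfl u hu).1 (hV s hts u hu).1
  · refine AEStronglyMeasurable.congr (f := fun u =>
      (X ^ ((1:ℝ)/2) * (u ^ ((1:ℝ)/2 - H) * (G t u).toReal)) *
      (X ^ ((1:ℝ)/2) * (u ^ ((1:ℝ)/2 - H) * (G s u).toReal))) ?_ ?_
    · have m1 := hGm t
      have m2 := hGm s
      exact Measurable.aestronglyMeasurable (by fun_prop)
    · filter_upwards [ae_restrict_mem measurableSet_Ioc] with u hu
      rw [(hV t le_rfl u hu).2, (hV s hts u hu).2]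
  have key : ∫⁻ u in Ioc (0:ℝ) t, ENNReal.ofReal (volterraKernel H t u * volterraKernel H s u) =
      ENNReal.ofReal X * ∫⁻ u in Ioc (0:ℝ) t, ENNReal.ofReal (u ^ (-(2 * (H - 1/2)))) *
        (G t u * G s u) := by
    rw [← lintegral_const_mul' _ _ ENNReal.ofReal_ne_top]
    refine setLIntegral_congr_fun measurableSet_Ioc fun u hu => ?_
    rw [(hV t le_rfl u hu).2, (hV s hts u hu).2]
    have e1 : u ^ (-(2 * (H - 1/2))) = u ^ ((1:ℝ)/2 - H) * u ^ ((1:ℝ)/2 - H) := by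
      rw [← rpow_add hu.1]; congr 1; ring
    have e2 : X = X ^ ((1:ℝ)/2) * X ^ ((1:ℝ)/2) := by
      rw [← sqrt_eq_rpow, mul_self_sqrt hX]
    have hu0 := hu.1
    rw [← ENNReal.ofReal_toReal (hGtop t le_rfl u hu), ← ENNReal.ofReal_toReal (hGtop s hts u hu),
      ← ENNReal.ofReal_mul ENNReal.toReal_nonneg, ← ENNReal.ofReal_mul (by positivity),
      ← ENNReal.ofReal_mul hX, e1]
    simp only [ENNReal.toReal_ofReal ENNReal.toReal_nonneg]
    congr 1
    calc _ = (X ^ ((1:ℝ)/2) * X ^ ((1:ℝ)/2)) * (u ^ ((1:ℝ)/2 - H) * u ^ ((1:ℝ)/2 - H) *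
          ((G t u).toReal * (G s u).toReal)) := by ring
      _ = _ := by rw [← e2]
  rw [key, aux_main (by linarith) (by linarith) hts,
    show 2 * (H - 1/2) - 1 = (2 * H - 1) - 1 by ring, aux_outer (by linarith) ht hts,
    show 1 - 2 * (H - 1/2) = 2 - 2 * H by ring, ← mul_assoc, ← ENNReal.ofReal_mul hX,
    ENNReal.toReal_mul, ENNReal.toReal_ofReal (mul_nonneg hX hB.le), ENNReal.toReal_ofReal]
  · rw [hXdef, abs_sub_comm, abs_of_nonneg (sub_nonneg.2 hts), sub_add_cancel,
      div_mul_cancel₀ _ hB.ne']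
    have : 2 * H - 1 ≠ 0 := by linarith
    have : H ≠ 0 := by linarith
    rw [show s ^ (2 * H) + t ^ (2 * H) - (s - t) ^ (2 * H) =
      t ^ (2 * H) + s ^ (2 * H) - (s - t) ^ (2 * H) by ring]
    generalize t ^ (2 * H) + s ^ (2 * H) - (s - t) ^ (2 * H) = R
    rw [mul_div_assoc', div_eq_iff (by positivity)]
    ring
  · refine div_nonneg ?_ (mul_nonneg (by linarith) (by linarith))
    have h1 : (s - t) ^ (2 * H - 1 + 1) ≤ s ^ (2 * H - 1 + 1) :=
      rpow_le_rpow (by linarith) (by linarith) (by linarith)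
    have h2 : 0 ≤ t ^ (2 * H - 1 + 1) := rpow_nonneg ht _
    linarith

/-- the Volterra kernel reproduces the fBm covariance. -/
theorem stmt7 (T H : ℝ) (hT : 0 < T) (hH : H ∈ Ioo (1/2 : ℝ) 1)
    (s t : ℝ) (hs : s ∈ Icc (0:ℝ) T) (ht : t ∈ Icc (0:ℝ) T) :
    ∫ u in Ioc (0:ℝ) (min s t), volterraKernel H t u * volterraKernel H s u
      = (1/2) * (s ^ (2 * H) + t ^ (2 * H) - |t - s| ^ (2 * H)) := by
  rcases le_total t s with h | h
  · rw [min_eq_right h]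
    exact aux_final hH ht.1 h
  · rw [min_eq_left h]
    simp_rw [mul_comm (volterraKernel H t _)]
    rw [aux_final hH hs.1 h, abs_sub_comm]
    ring
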